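/- arXiv:2405.16332 — 16 statements merged into one kernel-verified Lean document; each statement's English description precedes it below -/
import Mathlib

section
/- Let N be a φ-classical 1-absorbing prime submodule of M. Then for all nonunit elements a, b, c ∈ R and every m ∈ M, the ideal (N :_R abcm) equals the union (φ(N) :_R abcm) ∪ (N :_R abm) ∪ (N :_R cm) (as subsets of R). -/
/-- If `N` is a `φ`-classical 1-absorbing prime submodule of `M`, then for all
nonunits `a, b, c ∈ R` and every `m ∈ M`, we have
`(N :_R abcm) = (φ(N) :_R abcm) ∪ (N :_R abm) ∪ (N :_R cm)` as subsets of `R`. -/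
theorem phi_classical_one_absorbing_colon_union
    {R M : Type*} [CommRing R] [AddCommGroup M] [Module R M]
    (φ : Submodule R M → Submodule R M) (hφ : ∀ K : Submodule R M, φ K ≤ K)
    (N : Submodule R M) (hNproper : N ≠ ⊤)
    (hN : ∀ a b c : R, ¬ IsUnit a → ¬ IsUnit b → ¬ IsUnit c → ∀ m : M,
      (a * b * c) • m ∈ N → (a * b * c) • m ∉ φ N → (a * b) • m ∈ N ∨ c • m ∈ N)
    (a b c : R) (ha : ¬ IsUnit a) (hb : ¬ IsUnit b) (hc : ¬ IsUnit c) (m : M) :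
    {r : R | r • ((a * b * c) • m) ∈ N} =
      {r : R | r • ((a * b * c) • m) ∈ φ N} ∪
        {r : R | r • ((a * b) • m) ∈ N} ∪ {r : R | r • (c • m) ∈ N} := by
  ext r
  simp only [Set.mem_union, Set.mem_ofPred_eq]
  constructor
  · intro h
    by_cases hr : r • ((a * b * c) • m) ∈ φ N
    · exact Or.inl (Or.inl hr)
    · rw [smul_comm] at h hr
      rcases hN a b c ha hb hc (r • m) h hr with h | h
      · exact Or.inl (Or.inr (by rwa [smul_comm]))
      · exact Or.inr (by rwa [smul_comm])
  · rintro ((h | h) | h)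
    · exact hφ N h
    · have key : r • ((a * b * c) • m) = c • (r • ((a * b) • m)) := by
        simp only [smul_smul]
        congr 1
        ring
      rw [key]
      exact N.smul_mem c h
    · have key : r • ((a * b * c) • m) = (a * b) • (r • (c • m)) := by
        simp only [smul_smul]
        congr 1
        ring
      rw [key]
      exact N.smul_mem (a * b) h
end

section
/- Suppose that R satisfies the u-ring property that every ideal of R contained in the union of three ideals of R is contained in one of them. If N is a φ-classical 1-absorbing prime submodule of M, then for all nonunit elements a, b, c ∈ R and every m ∈ M, either (N :_R abcm) = (φ(N) :_R abcm), or (N :_R abcm) = (N :_R abm), or (N :_R abcm) = (N :_R cm). -/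
/-- Over a `u`-ring (every ideal contained in the union of three ideals is
contained in one of them), if `N` is a `φ`-classical 1-absorbing prime submodule of `M`, then
for all nonunits `a, b, c ∈ R` and `m ∈ M`, either `(N :_R abcm) = (φ(N) :_R abcm)` or
`(N :_R abcm) = (N :_R abm)` or `(N :_R abcm) = (N :_R cm)`. -/
theorem phi_classical_one_absorbing_colon_eq_of_uRing
    {R M : Type*} [CommRing R] [AddCommGroup M] [Module R M]
    (hu : ∀ I J₁ J₂ J₃ : Ideal R, (I : Set R) ⊆ (J₁ : Set R) ∪ (J₂ : Set R) ∪ (J₃ : Set R) →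
      I ≤ J₁ ∨ I ≤ J₂ ∨ I ≤ J₃)
    (φ : Submodule R M → Submodule R M) (hφ : ∀ K : Submodule R M, φ K ≤ K)
    (N : Submodule R M) (hNproper : N ≠ ⊤)
    (hN : ∀ a b c : R, ¬ IsUnit a → ¬ IsUnit b → ¬ IsUnit c → ∀ m : M,
      (a * b * c) • m ∈ N → (a * b * c) • m ∉ φ N → (a * b) • m ∈ N ∨ c • m ∈ N)
    (a b c : R) (ha : ¬ IsUnit a) (hb : ¬ IsUnit b) (hc : ¬ IsUnit c) (m : M) :
    N.comap (LinearMap.toSpanSingleton R M ((a * b * c) • m)) =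
        (φ N).comap (LinearMap.toSpanSingleton R M ((a * b * c) • m)) ∨
      N.comap (LinearMap.toSpanSingleton R M ((a * b * c) • m)) =
        N.comap (LinearMap.toSpanSingleton R M ((a * b) • m)) ∨
      N.comap (LinearMap.toSpanSingleton R M ((a * b * c) • m)) =
        N.comap (LinearMap.toSpanSingleton R M (c • m)) := by
  have hcover : (N.comap (LinearMap.toSpanSingleton R M ((a * b * c) • m)) : Set R) ⊆
      ((φ N).comap (LinearMap.toSpanSingleton R M ((a * b * c) • m)) : Set R) ∪
        (N.comap (LinearMap.toSpanSingleton R M ((a * b) • m)) : Set R) ∪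
        (N.comap (LinearMap.toSpanSingleton R M (c • m)) : Set R) := by
    intro r hr
    simp only [Set.mem_union, SetLike.mem_coe, Submodule.mem_comap,
      LinearMap.toSpanSingleton_apply] at hr ⊢
    rw [smul_comm r (a * b * c) m] at hr ⊢
    rw [smul_comm r (a * b) m, smul_comm r c m]
    by_cases hr' : (a * b * c) • r • m ∈ φ N
    · exact Or.inl (Or.inl hr')
    · rcases hN a b c ha hb hc (r • m) hr hr' with h | h
      · exact Or.inl (Or.inr h)
      · exact Or.inr h
  refine (hu _ _ _ _ hcover).imp (fun h => le_antisymm h (Submodule.comap_mono (hφ N)))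
    (Or.imp (fun h => le_antisymm h fun r hr => ?_) (fun h => le_antisymm h fun r hr => ?_))
  · simp only [Submodule.mem_comap, LinearMap.toSpanSingleton_apply] at hr ⊢
    convert N.smul_mem c hr using 1
    module
  · simp only [Submodule.mem_comap, LinearMap.toSpanSingleton_apply] at hr ⊢
    convert N.smul_mem (a * b) hr using 1
    module
end

section
/- Let N be a proper submodule of M. Then N is a φ-classical 1-absorbing prime submodule of M if and only if for all nonunit elements a, b ∈ R and m ∈ M with abm ∉ N, either (N :_R abm) = (φ(N) :_R abm) or (N :_R abm) = (N :_R m). -/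
/-- A proper submodule `N` of `M` is `φ`-classical 1-absorbing prime iff for
all nonunits `a, b ∈ R` and `m ∈ M` with `abm ∉ N`, either `(N :_R abm) = (φ(N) :_R abm)` or
`(N :_R abm) = (N :_R m)`. -/
theorem phi_classical_one_absorbing_iff_colon
    {R M : Type*} [CommRing R] [AddCommGroup M] [Module R M]
    (φ : Submodule R M → Submodule R M) (hφ : ∀ K : Submodule R M, φ K ≤ K)
    (N : Submodule R M) (hNproper : N ≠ ⊤) :
    (∀ a b c : R, ¬ IsUnit a → ¬ IsUnit b → ¬ IsUnit c → ∀ m : M,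
        (a * b * c) • m ∈ N → (a * b * c) • m ∉ φ N → (a * b) • m ∈ N ∨ c • m ∈ N) ↔
      (∀ a b : R, ¬ IsUnit a → ¬ IsUnit b → ∀ m : M, (a * b) • m ∉ N →
        N.comap (LinearMap.toSpanSingleton R M ((a * b) • m)) =
            (φ N).comap (LinearMap.toSpanSingleton R M ((a * b) • m)) ∨
          N.comap (LinearMap.toSpanSingleton R M ((a * b) • m)) =
            N.comap (LinearMap.toSpanSingleton R M m)) := by
  constructor
  · intro h a b ha hb m hm
    have hφN : (φ N).comap (LinearMap.toSpanSingleton R M ((a * b) • m)) ≤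
        N.comap (LinearMap.toSpanSingleton R M ((a * b) • m)) := Submodule.comap_mono (hφ N)
    have hNm : N.comap (LinearMap.toSpanSingleton R M m) ≤
        N.comap (LinearMap.toSpanSingleton R M ((a * b) • m)) := by
      intro c hc
      simp only [Submodule.mem_comap, LinearMap.toSpanSingleton_apply] at hc ⊢
      rw [smul_comm]
      exact N.smul_mem _ hc
    refine (Ideal.subset_union.mp fun c hc => ?_).imp
      (fun hle => le_antisymm hle hφN) (fun hle => le_antisymm hle hNm)
    simp only [SetLike.mem_coe, Submodule.mem_comap, LinearMap.toSpanSingleton_apply,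
      Set.mem_union] at hc ⊢
    by_contra! hcon
    have hc_unit : ¬ IsUnit c := fun hu => hm ((N.smul_mem_iff_of_isUnit hu).mp hc)
    have hcomm : (a * b * c) • m = c • (a * b) • m := by rw [smul_smul, mul_comm]
    exact (h a b c ha hb hc_unit m (hcomm ▸ hc) (hcomm ▸ hcon.1)).elim hm hcon.2
  · intro h a b c ha hb _ m hN hφN
    by_contra! hcon
    have hcomm : (a * b * c) • m = c • (a * b) • m := by rw [smul_smul, mul_comm]
    rw [hcomm] at hN hφN
    rcases h a b ha hb m hcon.1 with heq | heq
    · exact hφN (by simpa using (SetLike.ext_iff.mp heq c).mp (by simpa using hN))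
    · exact hcon.2 (by simpa using (SetLike.ext_iff.mp heq c).mp (by simpa using hN))
end

section
/- Let N be a proper submodule of M. Then N is a φ-classical 1-absorbing prime submodule of M if and only if for all nonunit elements a, b ∈ R, every proper ideal I of R and every m ∈ M with abIm ⊆ N and abIm ⊄ φ(N), either aIm ⊆ N or bm ∈ N. -/
theorem Ideal.span_singleton_mul_smul_span_singleton_le_iff
    {R M : Type*} [CommRing R] [AddCommGroup M] [Module R M]
    (a : R) (I : Ideal R) (m : M) (K : Submodule R M) :
    (Ideal.span {a} * I) • Submodule.span R {m} ≤ K ↔ ∀ x ∈ I, (a * x) • m ∈ K := by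
  rw [Submodule.smul_le]
  constructor
  · intro h x hx
    exact h _ (Ideal.mul_mem_mul (Ideal.mem_span_singleton_self a) hx) _
      (Submodule.mem_span_singleton_self m)
  · intro h r hr n hn
    obtain ⟨x, hx, rfl⟩ := Ideal.mem_span_singleton_mul.mp hr
    obtain ⟨t, rfl⟩ := Submodule.mem_span_singleton.mp hn
    rw [smul_comm]
    exact K.smul_mem t (h x hx)

/-- A proper submodule `N` of `M` is `φ`-classical 1-absorbing prime iff for all
nonunits `a, b ∈ R`, every proper ideal `I` of `R` and every `m ∈ M` with `abIm ⊆ N` and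
`abIm ⊄ φ(N)`, either `aIm ⊆ N` or `bm ∈ N`. -/
theorem phi_classical_one_absorbing_iff_ideal_elem
    {R M : Type*} [CommRing R] [AddCommGroup M] [Module R M]
    (φ : Submodule R M → Submodule R M) (hφ : ∀ K : Submodule R M, φ K ≤ K)
    (N : Submodule R M) (hNproper : N ≠ ⊤) :
    (∀ a b c : R, ¬ IsUnit a → ¬ IsUnit b → ¬ IsUnit c → ∀ m : M,
        (a * b * c) • m ∈ N → (a * b * c) • m ∉ φ N → (a * b) • m ∈ N ∨ c • m ∈ N) ↔
      (∀ a b : R, ¬ IsUnit a → ¬ IsUnit b → ∀ I : Ideal R, I ≠ ⊤ → ∀ m : M,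
        (Ideal.span {a} * Ideal.span {b} * I) • Submodule.span R {m} ≤ N →
        ¬ (Ideal.span {a} * Ideal.span {b} * I) • Submodule.span R {m} ≤ φ N →
        (Ideal.span {a} * I) • Submodule.span R {m} ≤ N ∨ b • m ∈ N) := by
  simp only [Ideal.span_singleton_mul_span_singleton,
    Ideal.span_singleton_mul_smul_span_singleton_le_iff]
  constructor
  · intro h a b ha hb I hI m hN hφN
    refine or_iff_not_imp_right.mpr fun hbm => ?_
    have mem_of_notMem : ∀ z ∈ I, (a * b * z) • m ∉ φ N → (a * z) • m ∈ N := fun z hz hzφ => by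
      have hzu : ¬ IsUnit z := fun hu => hI (I.eq_top_of_isUnit_mem hz hu)
      rw [mul_right_comm] at hzφ
      exact (h a z b ha hzu hb m (mul_right_comm a b z ▸ hN z hz) hzφ).resolve_right hbm
    push Not at hφN
    obtain ⟨y, hy, hyφ⟩ := hφN
    intro x hx
    by_cases hxφ : (a * b * x) • m ∈ φ N
    · have hxy : (a * b * (x + y)) • m ∉ φ N := by
        rwa [mul_add, add_smul, Submodule.add_mem_iff_right _ hxφ]
      have hsum := mem_of_notMem (x + y) (I.add_mem hx hy) hxy
      rwa [mul_add, add_smul, Submodule.add_mem_iff_left _ (mem_of_notMem y hy hyφ)] at hsum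
    · exact mem_of_notMem x hx hxφ
  · intro h a b c ha hb hc m hN hφN
    rw [mul_right_comm] at hN hφN
    refine (h a c ha hc (Ideal.span {b}) (mt Ideal.span_singleton_eq_top.mp hb) m ?_ ?_).imp_left
      fun hab => hab b (Ideal.mem_span_singleton_self b)
    · intro x hx
      obtain ⟨t, rfl⟩ := Ideal.mem_span_singleton'.mp hx
      rw [mul_left_comm, mul_smul]
      exact N.smul_mem t hN
    · exact fun hle => hφN (hle b (Ideal.mem_span_singleton_self b))
end

section
/- Let N be a proper submodule of M. Then N is a φ-classical 1-absorbing prime submodule of M if and only if for all proper ideals I, J, K of R and every m ∈ M with IJKm ⊆ N and IJKm ⊄ φ(N), either IJm ⊆ N or Km ⊆ N. -/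
theorem Submodule.smul_span_singleton_le_iff {R M : Type*} [CommRing R] [AddCommGroup M]
    [Module R M] (I : Ideal R) (m : M) (N : Submodule R M) :
    I • Submodule.span R {m} ≤ N ↔ I ≤ N.comap (LinearMap.toSpanSingleton R M m) := by
  refine ⟨fun h r hr => h (Submodule.smul_mem_smul hr (Submodule.mem_span_singleton_self m)),
    fun h => Submodule.smul_le.2 fun r hr x hx => ?_⟩
  obtain ⟨s, rfl⟩ := Submodule.mem_span_singleton.1 hx
  rw [smul_comm]
  exact N.smul_mem s (h hr)

/-- If `abc ∈ A \ B` forces `ab ∈ A` or `c ∈ A` elementwise on `I × J × K`, then the same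
implication holds for the ideals themselves. -/
theorem Ideal.mul_le_or_le_of_forall_mem {R : Type*} [CommRing R] {A B I J K : Ideal R}
    (h : ∀ a ∈ I, ∀ b ∈ J, ∀ c ∈ K, a * b * c ∈ A → a * b * c ∉ B → a * b ∈ A ∨ c ∈ A)
    (hA : I * J * K ≤ A) (hB : ¬ I * J * K ≤ B) : I * J ≤ A ∨ K ≤ A := by
  by_contra! hcon
  obtain ⟨hIJ, hK⟩ := hcon
  have key : ∀ a ∈ I, ∀ b ∈ J, ∀ c ∈ K, a * b ∉ A → c ∉ A → a * b * c ∈ B := by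
    intro a ha b hb c hc hab hcA
    by_contra hn
    exact (h a ha b hb c hc (hA (Ideal.mul_mem_mul (Ideal.mul_mem_mul ha hb) hc)) hn).elim
      hab hcA
  obtain ⟨k, hk, hkA⟩ := SetLike.not_le_iff_exists.1 hK
  obtain ⟨i, hi, j, hj, hij⟩ : ∃ i ∈ I, ∃ j ∈ J, i * j ∉ A := by
    by_contra! hn
    exact hIJ (Ideal.mul_le.2 hn)
  have key' : ∀ a ∈ I, ∀ b ∈ J, ∀ c ∈ K, c ∉ A → a * b * c ∈ B := by
    intro a ha b hb c hc hcA
    by_cases hab : a * b ∈ A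
    swap
    · exact key a ha b hb c hc hab hcA
    have hijc := key i hi j hj c hc hij hcA
    by_cases hib : i * b ∈ A
    swap
    · have h₁ := key i hi b hb c hc hib hcA
      have h₂ := key (i + a) (I.add_mem hi ha) b hb c hc
        (by rwa [add_mul, A.add_mem_iff_left hab]) hcA
      rwa [add_mul, add_mul, B.add_mem_iff_right h₁] at h₂
    by_cases haj : a * j ∈ A
    swap
    · have h₁ := key a ha j hj c hc haj hcA
      have h₂ := key a ha (j + b) (J.add_mem hj hb) c hc
        (by rwa [mul_add, A.add_mem_iff_left hab]) hcA
      rwa [mul_add, add_mul, B.add_mem_iff_right h₁] at h₂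
    have hibc : i * b * c ∈ B := by
      have h₂ := key i hi (j + b) (J.add_mem hj hb) c hc
        (by rwa [mul_add, A.add_mem_iff_left hib]) hcA
      rwa [mul_add, add_mul, B.add_mem_iff_right hijc] at h₂
    have hajc : a * j * c ∈ B := by
      have h₂ := key (i + a) (I.add_mem hi ha) j hj c hc
        (by rwa [add_mul, A.add_mem_iff_left haj]) hcA
      rwa [add_mul, add_mul, B.add_mem_iff_right hijc] at h₂
    have h₂ := key (i + a) (I.add_mem hi ha) (j + b) (J.add_mem hj hb) c hc
      (by rwa [add_mul, mul_add, mul_add, A.add_mem_iff_left (A.add_mem haj hab),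
        A.add_mem_iff_left hib]) hcA
    rwa [add_mul, mul_add, mul_add, add_mul, add_mul, add_mul,
      B.add_mem_iff_right (B.add_mem hijc hibc), B.add_mem_iff_right hajc] at h₂
  refine hB (Ideal.mul_le.2 fun r hr c hc => ?_)
  refine Submodule.mul_induction_on hr (fun a ha b hb => ?_) fun x y hx hy => ?_
  · by_cases hcA : c ∈ A
    · have h₁ := key' a ha b hb k hk hkA
      have h₂ := key' a ha b hb (c + k) (K.add_mem hc hk) (by rwa [A.add_mem_iff_right hcA])
      rwa [mul_add, B.add_mem_iff_left h₁] at h₂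
    · exact key' a ha b hb c hc hcA
  · rw [add_mul]
    exact B.add_mem hx hy


/-- A proper submodule `N` of `M` is `φ`-classical 1-absorbing prime iff for all
proper ideals `I, J, K` of `R` and every `m ∈ M` with `IJKm ⊆ N` and `IJKm ⊄ φ(N)`, either
`IJm ⊆ N` or `Km ⊆ N`. -/
theorem phi_classical_one_absorbing_iff_three_ideals
    {R M : Type*} [CommRing R] [AddCommGroup M] [Module R M]
    (φ : Submodule R M → Submodule R M) (hφ : ∀ K : Submodule R M, φ K ≤ K)
    (N : Submodule R M) (hNproper : N ≠ ⊤) :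
    (∀ a b c : R, ¬ IsUnit a → ¬ IsUnit b → ¬ IsUnit c → ∀ m : M,
        (a * b * c) • m ∈ N → (a * b * c) • m ∉ φ N → (a * b) • m ∈ N ∨ c • m ∈ N) ↔
      (∀ I J K : Ideal R, I ≠ ⊤ → J ≠ ⊤ → K ≠ ⊤ → ∀ m : M,
        (I * J * K) • Submodule.span R {m} ≤ N →
        ¬ (I * J * K) • Submodule.span R {m} ≤ φ N →
        (I * J) • Submodule.span R {m} ≤ N ∨ K • Submodule.span R {m} ≤ N) := by
  constructor
  · intro h I J K hI hJ hK m
    have nonunit {L : Ideal R} (hL : L ≠ ⊤) {x : R} (hx : x ∈ L) : ¬ IsUnit x :=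
      fun hu => hL (L.eq_top_of_isUnit_mem hx hu)
    simp only [Submodule.smul_span_singleton_le_iff]
    exact Ideal.mul_le_or_le_of_forall_mem fun a ha b hb c hc =>
      h a b c (nonunit hI ha) (nonunit hJ hb) (nonunit hK hc) m
  · intro h a b c ha hb hc m
    have h' := h (Ideal.span {a}) (Ideal.span {b}) (Ideal.span {c})
      (by rwa [Ne, Ideal.span_singleton_eq_top]) (by rwa [Ne, Ideal.span_singleton_eq_top])
      (by rwa [Ne, Ideal.span_singleton_eq_top]) m
    simpa only [Submodule.smul_span_singleton_le_iff, Ideal.span_singleton_mul_span_singleton,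
      Ideal.span_singleton_le_iff_mem, Submodule.mem_comap,
      LinearMap.toSpanSingleton_apply] using h'
end

section
/- Let N be a proper submodule of M. Then N is a φ-classical 1-absorbing prime submodule of M if and only if N/φ(N) is a weakly classical 1-absorbing prime submodule of the quotient module M/φ(N). -/
/-- A proper submodule `N` of `M` is a `φ`-classical 1-absorbing prime submodule
iff `N/φ(N)` is a weakly classical 1-absorbing prime submodule of `M/φ(N)`. -/
theorem phi_classical_one_absorbing_iff_quotient_weakly
    {R M : Type*} [CommRing R] [AddCommGroup M] [Module R M]
    (φ : Submodule R M → Submodule R M) (hφ : ∀ K : Submodule R M, φ K ≤ K)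
    (N : Submodule R M) (hNproper : N ≠ ⊤) :
    (∀ a b c : R, ¬ IsUnit a → ¬ IsUnit b → ¬ IsUnit c → ∀ m : M,
        (a * b * c) • m ∈ N → (a * b * c) • m ∉ φ N → (a * b) • m ∈ N ∨ c • m ∈ N) ↔
      (N.map (φ N).mkQ ≠ ⊤ ∧
        ∀ a b c : R, ¬ IsUnit a → ¬ IsUnit b → ¬ IsUnit c → ∀ x : M ⧸ φ N,
          (a * b * c) • x ≠ 0 → (a * b * c) • x ∈ N.map (φ N).mkQ →
          (a * b) • x ∈ N.map (φ N).mkQ ∨ c • x ∈ N.map (φ N).mkQ) := by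
  have mem_map : ∀ m : M, (φ N).mkQ m ∈ N.map (φ N).mkQ ↔ m ∈ N := fun m => by
    rw [← Submodule.mem_comap, Submodule.comap_map_mkQ, sup_eq_right.mpr (hφ N)]
  have mkQ_eq_zero : ∀ m : M, (φ N).mkQ m = 0 ↔ m ∈ φ N := fun m => by
    rw [← LinearMap.mem_ker, Submodule.ker_mkQ]
  have map_ne_top : N.map (φ N).mkQ ≠ ⊤ := fun h =>
    hNproper <| (Submodule.eq_top_iff').mpr fun m => (mem_map m).mp (h ▸ Submodule.mem_top)
  constructor
  · refine fun h => ⟨map_ne_top, fun a b c ha hb hc x hx0 hx => ?_⟩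
    obtain ⟨m, rfl⟩ := (φ N).mkQ_surjective x
    simp only [← map_smul, mem_map, ne_eq, mkQ_eq_zero] at hx0 hx ⊢
    exact h a b c ha hb hc m hx hx0
  · rintro ⟨-, h⟩ a b c ha hb hc m hm hm0
    have hquot := h a b c ha hb hc ((φ N).mkQ m)
    simp only [← map_smul, mem_map, ne_eq, mkQ_eq_zero] at hquot
    exact hquot hm0 hm
end

section
/- Let K ⊆ N be proper submodules of M with φ(K) ⊆ φ(N). If K is a φ-classical 1-absorbing prime submodule of M and N/K is a weakly classical 1-absorbing prime submodule of M/K, then N is a φ-classical 1-absorbing prime submodule of M. -/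
/-- For `K ≤ N`, the class of `x` lies in the image of `N` in `M ⧸ K` exactly when `x ∈ N`. -/
theorem Submodule.mkQ_mem_map_mkQ_iff {R M : Type*} [Ring R] [AddCommGroup M] [Module R M]
    {K N : Submodule R M} (hKN : K ≤ N) {x : M} : K.mkQ x ∈ N.map K.mkQ ↔ x ∈ N := by
  rw [← Submodule.mem_comap, Submodule.comap_map_mkQ, sup_eq_right.mpr hKN]

/-- Let `K ⊆ N` be proper submodules of `M` with `φ(K) ⊆ φ(N)`. If `K` is a
`φ`-classical 1-absorbing prime submodule of `M` and `N/K` is a weakly classical 1-absorbing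
prime submodule of `M/K`, then `N` is a `φ`-classical 1-absorbing prime submodule of `M`. -/
theorem phi_classical_one_absorbing_of_quotient_weakly
    {R M : Type*} [CommRing R] [AddCommGroup M] [Module R M]
    (φ : Submodule R M → Submodule R M) (hφ : ∀ L : Submodule R M, φ L ≤ L)
    (K N : Submodule R M) (hKN : K ≤ N) (hKproper : K ≠ ⊤) (hNproper : N ≠ ⊤)
    (hφKN : φ K ≤ φ N)
    (hK : ∀ a b c : R, ¬ IsUnit a → ¬ IsUnit b → ¬ IsUnit c → ∀ m : M,
      (a * b * c) • m ∈ K → (a * b * c) • m ∉ φ K → (a * b) • m ∈ K ∨ c • m ∈ K)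
    (hNK : N.map K.mkQ ≠ ⊤ ∧
      ∀ a b c : R, ¬ IsUnit a → ¬ IsUnit b → ¬ IsUnit c → ∀ x : M ⧸ K,
        (a * b * c) • x ≠ 0 → (a * b * c) • x ∈ N.map K.mkQ →
        (a * b) • x ∈ N.map K.mkQ ∨ c • x ∈ N.map K.mkQ) :
    ∀ a b c : R, ¬ IsUnit a → ¬ IsUnit b → ¬ IsUnit c → ∀ m : M,
      (a * b * c) • m ∈ N → (a * b * c) • m ∉ φ N → (a * b) • m ∈ N ∨ c • m ∈ N := by
  intro a b c ha hb hc m hmN hmφ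
  by_cases hmK : (a * b * c) • m ∈ K
  · exact (hK a b c ha hb hc m hmK fun h => hmφ (hφKN h)).imp (@hKN _) (@hKN _)
  · have h := hNK.2 a b c ha hb hc (K.mkQ m)
    simp only [← map_smul, Submodule.mkQ_mem_map_mkQ_iff hKN] at h
    refine h (fun h0 => hmK ?_) hmN
    rwa [Submodule.mkQ_apply, Submodule.Quotient.mk_eq_zero] at h0
end

section
/- Let M be a multiplication R-module, let N be a proper submodule of M, and let n ≥ 2 and 2 ≤ k ≤ n. Suppose N is an n-almost classical 1-absorbing prime submodule of M (that is, φ-classical 1-absorbing prime for φ(N) = (N :_R M)^{n-1} N) and N is k-potent classical 1-absorbing prime (that is, whenever nonunits a, b, c ∈ R and m ∈ M satisfy abcm ∈ N^k, then abm ∈ N or cm ∈ N, where N^k = (N :_R M)^k M). Then N is a classical 1-absorbing prime submodule of M. -/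
/-- Let `M` be a multiplication `R`-module and `N` a proper submodule. If `N`
is an `n`-almost classical 1-absorbing prime submodule (`n ≥ 2`) and `N` is `k`-potent classical
1-absorbing prime for some `2 ≤ k ≤ n`, then `N` is a classical 1-absorbing prime submodule. -/
theorem classical_one_absorbing_of_n_almost_and_k_potent
    {R M : Type*} [CommRing R] [AddCommGroup M] [Module R M]
    (hmul : ∀ K : Submodule R M, ∃ I : Ideal R, K = I • (⊤ : Submodule R M))
    (N : Submodule R M) (hNproper : N ≠ ⊤)
    (n k : ℕ) (hn : 2 ≤ n) (hk2 : 2 ≤ k) (hkn : k ≤ n)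
    (halmost : ∀ a b c : R, ¬ IsUnit a → ¬ IsUnit b → ¬ IsUnit c → ∀ m : M,
      (a * b * c) • m ∈ N → (a * b * c) • m ∉ (N.colon ⊤) ^ (n - 1) • N →
      (a * b) • m ∈ N ∨ c • m ∈ N)
    (hpotent : ∀ a b c : R, ¬ IsUnit a → ¬ IsUnit b → ¬ IsUnit c → ∀ m : M,
      (a * b * c) • m ∈ (N.colon ⊤) ^ k • (⊤ : Submodule R M) →
      (a * b) • m ∈ N ∨ c • m ∈ N) :
    ∀ a b c : R, ¬ IsUnit a → ¬ IsUnit b → ¬ IsUnit c → ∀ m : M,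
      (a * b * c) • m ∈ N → (a * b) • m ∈ N ∨ c • m ∈ N := by
  intro a b c ha hb hc m hm
  by_cases h : (a * b * c) • m ∈ (N.colon ⊤) ^ (n - 1) • N
  · refine hpotent a b c ha hb hc m ?_
    have hle : N ≤ N.colon ⊤ • (⊤ : Submodule R M) := by
      obtain ⟨I, hI⟩ := hmul N
      refine hI.trans_le (Submodule.smul_mono_left fun r hr => ?_)
      refine Submodule.mem_colon.mpr fun x _ => ?_
      rw [hI]
      exact Submodule.smul_mem_smul hr trivial
    have h' := smul_mono_right ((N.colon ⊤) ^ (n - 1)) hle h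
    rw [← Submodule.mul_smul, ← pow_succ, Nat.sub_add_cancel (by omega)] at h'
    exact Submodule.smul_mono_left (Ideal.pow_le_pow_right hkn) h'
  · exact halmost a b c ha hb hc m hm h
end

section
/- Let M be a cyclic R-module, generated by a single element, and let N be a proper submodule of M. Then N is a φ-1-absorbing prime submodule of M if and only if N is a φ-classical 1-absorbing prime submodule of M. -/
/-- Let `M` be a cyclic `R`-module and `N` a proper submodule of `M`. Then `N`
is a `φ`-1-absorbing prime submodule of `M` iff `N` is a `φ`-classical 1-absorbing prime
submodule of `M`. -/
theorem phi_one_absorbing_iff_phi_classical_of_cyclic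
    {R M : Type*} [CommRing R] [AddCommGroup M] [Module R M]
    (hcyc : ∃ m₀ : M, Submodule.span R {m₀} = ⊤)
    (φ : Submodule R M → Submodule R M) (hφ : ∀ K : Submodule R M, φ K ≤ K)
    (N : Submodule R M) (hNproper : N ≠ ⊤) :
    (∀ a b : R, ¬ IsUnit a → ¬ IsUnit b → ∀ m : M,
        (a * b) • m ∈ N → (a * b) • m ∉ φ N → m ∈ N ∨ a * b ∈ N.colon ⊤) ↔
      (∀ a b c : R, ¬ IsUnit a → ¬ IsUnit b → ¬ IsUnit c → ∀ m : M,
        (a * b * c) • m ∈ N → (a * b * c) • m ∉ φ N → (a * b) • m ∈ N ∨ c • m ∈ N) := by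
  obtain ⟨m₀, hm₀⟩ := hcyc
  have hgen (m : M) : ∃ r : R, r • m₀ = m :=
    Submodule.mem_span_singleton.mp (hm₀ ▸ Submodule.mem_top)
  constructor
  · intro h a b c ha hb _ m hm hmφ
    rw [mul_smul] at hm hmφ
    rcases h a b ha hb (c • m) hm hmφ with hcm | hab
    · exact Or.inr hcm
    · exact Or.inl (Submodule.mem_colon.mp hab m trivial)
  · intro h a b ha hb m hm hmφ
    have hcolon (hab : (a * b) • m₀ ∈ N) : a * b ∈ N.colon ⊤ := by
      refine Submodule.mem_colon.mpr fun x _ => ?_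
      obtain ⟨s, rfl⟩ := hgen x
      rw [smul_comm]
      exact N.smul_mem s hab
    obtain ⟨r, rfl⟩ := hgen m
    by_cases hr : IsUnit r
    · rw [smul_comm] at hm
      exact Or.inr (hcolon ((N.smul_mem_iff_of_isUnit hr).mp hm))
    · rw [← mul_smul] at hm hmφ
      exact (h a b r ha hb hr m₀ hm hmφ).symm.imp_right hcolon
end

section
/- Let f : M → M′ be a surjective homomorphism of R-modules, let φ (on submodules of M) and φ′ (on submodules of M′) be as in the context, and let N′ be a φ′-classical 1-absorbing prime submodule of M′ such that φ(f⁻¹(N′)) = f⁻¹(φ′(N′)). Then f⁻¹(N′) is a φ-classical 1-absorbing prime submodule of M. -/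
/-- Let `f : M → M′` be a surjective `R`-module homomorphism and `N′` a
`φ′`-classical 1-absorbing prime submodule of `M′` with `φ(f⁻¹(N′)) = f⁻¹(φ′(N′))`. Then
`f⁻¹(N′)` is a `φ`-classical 1-absorbing prime submodule of `M`. -/
theorem comap_phi_classical_one_absorbing
    {R M M' : Type*} [CommRing R] [AddCommGroup M] [Module R M]
    [AddCommGroup M'] [Module R M']
    (f : M →ₗ[R] M') (hf : Function.Surjective f)
    (φ : Submodule R M → Submodule R M) (hφ : ∀ K : Submodule R M, φ K ≤ K)
    (φ' : Submodule R M' → Submodule R M') (hφ' : ∀ K : Submodule R M', φ' K ≤ K)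
    (N' : Submodule R M') (hN'proper : N' ≠ ⊤)
    (hN' : ∀ a b c : R, ¬ IsUnit a → ¬ IsUnit b → ¬ IsUnit c → ∀ m : M',
      (a * b * c) • m ∈ N' → (a * b * c) • m ∉ φ' N' → (a * b) • m ∈ N' ∨ c • m ∈ N')
    (hcompat : φ (N'.comap f) = (φ' N').comap f) :
    N'.comap f ≠ ⊤ ∧
      ∀ a b c : R, ¬ IsUnit a → ¬ IsUnit b → ¬ IsUnit c → ∀ m : M,
        (a * b * c) • m ∈ N'.comap f → (a * b * c) • m ∉ φ (N'.comap f) →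
        (a * b) • m ∈ N'.comap f ∨ c • m ∈ N'.comap f := by
  refine ⟨fun h => hN'proper ?_, fun a b c ha hb hc m hm hm' => ?_⟩
  · rw [← Submodule.map_comap_eq_of_surjective hf N', h, Submodule.map_top,
      LinearMap.range_eq_top.2 hf]
  · rw [hcompat] at hm'
    simp only [Submodule.mem_comap, map_smul] at hm hm' ⊢
    exact hN' a b c ha hb hc (f m) hm hm'
end

section
/- Let f : M → M′ be a surjective homomorphism of R-modules, let φ (on submodules of M) and φ′ (on submodules of M′) be as in the context, and let N be a φ-classical 1-absorbing prime submodule of M with Ker(f) ⊆ N and φ′(f(N)) = f(φ(N)). Then f(N) is a φ′-classical 1-absorbing prime submodule of M′. -/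
/-- Let `f : M → M′` be a surjective `R`-module homomorphism and `N` a
`φ`-classical 1-absorbing prime submodule of `M` with `Ker(f) ⊆ N` and `φ′(f(N)) = f(φ(N))`.
Then `f(N)` is a `φ′`-classical 1-absorbing prime submodule of `M′`. -/
theorem map_phi_classical_one_absorbing
    {R M M' : Type*} [CommRing R] [AddCommGroup M] [Module R M]
    [AddCommGroup M'] [Module R M']
    (f : M →ₗ[R] M') (hf : Function.Surjective f)
    (φ : Submodule R M → Submodule R M) (hφ : ∀ K : Submodule R M, φ K ≤ K)
    (φ' : Submodule R M' → Submodule R M') (hφ' : ∀ K : Submodule R M', φ' K ≤ K)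
    (N : Submodule R M) (hNproper : N ≠ ⊤)
    (hN : ∀ a b c : R, ¬ IsUnit a → ¬ IsUnit b → ¬ IsUnit c → ∀ m : M,
      (a * b * c) • m ∈ N → (a * b * c) • m ∉ φ N → (a * b) • m ∈ N ∨ c • m ∈ N)
    (hker : LinearMap.ker f ≤ N)
    (hcompat : φ' (N.map f) = (φ N).map f) :
    N.map f ≠ ⊤ ∧
      ∀ a b c : R, ¬ IsUnit a → ¬ IsUnit b → ¬ IsUnit c → ∀ m' : M',
        (a * b * c) • m' ∈ N.map f → (a * b * c) • m' ∉ φ' (N.map f) →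
        (a * b) • m' ∈ N.map f ∨ c • m' ∈ N.map f := by
  have hcomap : (N.map f).comap f = N := Submodule.comap_map_eq_self hker
  have hmem : ∀ x : M, f x ∈ N.map f ↔ x ∈ N := fun x => by
    rw [← Submodule.mem_comap, hcomap]
  refine ⟨fun h => hNproper ?_, fun a b c ha hb hc m' hmN hmφ => ?_⟩
  · rw [← hcomap, h, Submodule.comap_top]
  · obtain ⟨m, rfl⟩ := hf m'
    rw [hcompat] at hmφ
    simp only [← map_smul, hmem] at hmN hmφ ⊢
    exact hN a b c ha hb hc m hmN fun h => hmφ (Submodule.mem_map_of_mem h)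
end

section
/- Suppose M satisfies the um-property that every submodule of M contained in the union of three submodules of M is contained in one of them. Let N be a proper submodule of M. Then N is a φ-classical 1-absorbing prime submodule of M if and only if for all proper ideals I, J, K of R and every submodule L of M with IJKL ⊆ N and IJKL ⊄ φ(N), either IJL ⊆ N or KL ⊆ N. -/
/-- If each product of elements of `I` and `J` lies in `A` or in `B`, then `I * J` is contained
in `A` or in `B`. -/
theorem Ideal.mul_le_or_mul_le_of_forall_mem {R : Type*} [CommRing R] {I J A B : Ideal R}
    (h : ∀ x ∈ I, ∀ y ∈ J, x * y ∈ A ∨ x * y ∈ B) : I * J ≤ A ∨ I * J ≤ B := by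
  have hJ : (J : Set R) ⊆ (A.colon (I : Set R) : Ideal R) ∪ (B.colon (I : Set R) : Ideal R) := by
    intro y hy
    have hI : (I : Set R) ⊆ (A.colon {y} : Ideal R) ∪ (B.colon {y} : Ideal R) := fun x hx => by
      simpa [Submodule.mem_colon] using h x hx y hy
    refine (Ideal.subset_union.1 hI).imp (fun hle => ?_) (fun hle => ?_) <;>
    · refine Submodule.mem_colon.2 fun x hx => ?_
      have := Submodule.mem_colon.1 (hle hx) y rfl
      simpa [mul_comm] using this
  refine (Ideal.subset_union.1 hJ).imp (fun hle => ?_) (fun hle => ?_) <;>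
  · refine Ideal.mul_le.2 fun x hx y hy => ?_
    have := Submodule.mem_colon.1 (hle hy) x hx
    simpa [mul_comm] using this

/-- If `x * y * z ∈ A`, `x * y ∈ B` or `z ∈ B` for all elements of three ideals, then the
corresponding alternative holds for the ideals themselves. -/
theorem Ideal.mul_mul_le_or_of_forall_mem {R : Type*} [CommRing R] {I J K A B : Ideal R}
    (h : ∀ x ∈ I, ∀ y ∈ J, ∀ z ∈ K, x * y * z ∈ A ∨ x * y ∈ B ∨ z ∈ B) :
    I * J * K ≤ A ∨ I * J ≤ B ∨ K ≤ B := by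
  by_cases hIJ : I * J ≤ B
  · exact .inr (.inl hIJ)
  have hK : (K : Set R) ⊆ (A.colon ((I * J : Ideal R) : Set R) : Ideal R) ∪ B := by
    intro z hz
    by_cases hzB : z ∈ B
    · exact .inr hzB
    have hz' : I * J ≤ A.colon {z} ∨ I * J ≤ B :=
      Ideal.mul_le_or_mul_le_of_forall_mem fun x hx y hy => by
        simpa [Submodule.mem_colon, hzB] using h x hx y hy z hz
    refine .inl (Submodule.mem_colon.2 fun w hw => ?_)
    have := Submodule.mem_colon.1 (hz'.resolve_right hIJ hw) z rfl
    simpa [mul_comm] using this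
  rcases Ideal.subset_union.1 hK with hle | hle
  · refine .inl (Ideal.mul_le.2 fun w hw z hz => ?_)
    have := Submodule.mem_colon.1 (hle hz) w hw
    simpa [mul_comm] using this
  · exact .inr (.inr hle)

/-- `I • L ≤ P` iff `I` is contained in the residual `P : L`. -/
theorem Submodule.smul_le_iff_le_colon {R M : Type*} [CommRing R] [AddCommGroup M] [Module R M]
    {I : Ideal R} {L P : Submodule R M} : I • L ≤ P ↔ I ≤ P.colon (L : Set M) :=
  Submodule.smul_le.trans (forall₂_congr fun _ _ => Submodule.mem_colon.symm)

/-- Suppose every submodule of `M` contained in the union of three submodules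
of `M` is contained in one of them (the `um`-property). Then a proper submodule `N` of `M` is
`φ`-classical 1-absorbing prime iff for all proper ideals `I, J, K` of `R` and every submodule
`L` of `M` with `IJKL ⊆ N` and `IJKL ⊄ φ(N)`, either `IJL ⊆ N` or `KL ⊆ N`. -/
theorem phi_classical_one_absorbing_iff_ideals_submodule_of_um
    {R M : Type*} [CommRing R] [AddCommGroup M] [Module R M]
    (hum : ∀ L L₁ L₂ L₃ : Submodule R M,
      (L : Set M) ⊆ (L₁ : Set M) ∪ (L₂ : Set M) ∪ (L₃ : Set M) →
      L ≤ L₁ ∨ L ≤ L₂ ∨ L ≤ L₃)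
    (φ : Submodule R M → Submodule R M) (hφ : ∀ K : Submodule R M, φ K ≤ K)
    (N : Submodule R M) (hNproper : N ≠ ⊤) :
    (∀ a b c : R, ¬ IsUnit a → ¬ IsUnit b → ¬ IsUnit c → ∀ m : M,
        (a * b * c) • m ∈ N → (a * b * c) • m ∉ φ N → (a * b) • m ∈ N ∨ c • m ∈ N) ↔
      (∀ I J K : Ideal R, I ≠ ⊤ → J ≠ ⊤ → K ≠ ⊤ → ∀ L : Submodule R M,
        (I * J * K) • L ≤ N → ¬ (I * J * K) • L ≤ φ N →
        (I * J) • L ≤ N ∨ K • L ≤ N) := by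
  constructor
  · intro h I J K hI hJ hK L hN hφN
    simp only [Submodule.smul_le_iff_le_colon] at hN hφN ⊢
    refine (Ideal.mul_mul_le_or_of_forall_mem fun a ha b hb c hc => ?_).resolve_left hφN
    have hN' := Submodule.mem_colon.1 (hN (Ideal.mul_mem_mul (Ideal.mul_mem_mul ha hb) hc))
    have nonunit {I : Ideal R} (hI : I ≠ ⊤) {x : R} (hx : x ∈ I) : ¬ IsUnit x :=
      fun hu => hI (I.eq_top_of_isUnit_mem hx hu)
    have hL := hum L ((φ N).comap (LinearMap.lsmul R M (a * b * c)))
      (N.comap (LinearMap.lsmul R M (a * b))) (N.comap (LinearMap.lsmul R M c)) fun m hm => by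
        have := h a b c (nonunit hI ha) (nonunit hJ hb) (nonunit hK hc) m (hN' m hm)
        simp only [Set.mem_union, SetLike.mem_coe, Submodule.mem_comap, LinearMap.lsmul_apply]
        tauto
    simp only [Submodule.mem_colon]
    exact hL
  · intro h a b c ha hb hc m hN hφN
    have key := h (Ideal.span {a}) (Ideal.span {b}) (Ideal.span {c})
      (by rwa [Ne, Ideal.span_singleton_eq_top]) (by rwa [Ne, Ideal.span_singleton_eq_top])
      (by rwa [Ne, Ideal.span_singleton_eq_top]) (Submodule.span R {m})
    simp only [Ideal.span_singleton_mul_span_singleton, Submodule.span_smul_span,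
      Set.singleton_smul_singleton, Submodule.span_singleton_le_iff_mem, Ideal.span] at key
    exact key hN hφN
end

section
/- Let a ∈ R be an element with aM ≠ M and suppose (0 :_M a) ⊆ aM, where (0 :_M a) = {m ∈ M : am = 0}. Then aM is an almost classical 1-absorbing prime submodule of M (that is, φ-classical 1-absorbing prime for φ(aM) = (aM :_R M)(aM)) if and only if aM is a classical 1-absorbing prime submodule of M. -/
theorem colon_smul_range_lsmul_le {R M : Type*} [CommRing R] [AddCommGroup M] [Module R M]
    (a : R) :
    (LinearMap.range (LinearMap.lsmul R M a)).colon (⊤ : Set M) •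
        LinearMap.range (LinearMap.lsmul R M a) ≤
      (LinearMap.range (LinearMap.lsmul R M a)).map (LinearMap.lsmul R M a) := by
  rw [Submodule.smul_le]
  rintro r hr _ ⟨k, rfl⟩
  exact ⟨r • k, Submodule.mem_colon.1 hr k trivial, smul_comm a r k⟩

/-- Let `a ∈ R` with `aM ≠ M` and `(0 :_M a) ⊆ aM`. Then `aM` is an almost
classical 1-absorbing prime submodule of `M` iff `aM` is a classical 1-absorbing prime
submodule of `M`. -/
theorem aM_almost_classical_iff_classical
    {R M : Type*} [CommRing R] [AddCommGroup M] [Module R M] (a : R)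
    (hproper : LinearMap.range (LinearMap.lsmul R M a) ≠ ⊤)
    (htor : ∀ m : M, a • m = 0 → m ∈ LinearMap.range (LinearMap.lsmul R M a)) :
    (∀ x y z : R, ¬ IsUnit x → ¬ IsUnit y → ¬ IsUnit z → ∀ m : M,
        (x * y * z) • m ∈ LinearMap.range (LinearMap.lsmul R M a) →
        (x * y * z) • m ∉
          ((LinearMap.range (LinearMap.lsmul R M a)).colon ⊤) •
            LinearMap.range (LinearMap.lsmul R M a) →
        (x * y) • m ∈ LinearMap.range (LinearMap.lsmul R M a) ∨
          z • m ∈ LinearMap.range (LinearMap.lsmul R M a)) ↔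
      (∀ x y z : R, ¬ IsUnit x → ¬ IsUnit y → ¬ IsUnit z → ∀ m : M,
        (x * y * z) • m ∈ LinearMap.range (LinearMap.lsmul R M a) →
        (x * y) • m ∈ LinearMap.range (LinearMap.lsmul R M a) ∨
          z • m ∈ LinearMap.range (LinearMap.lsmul R M a)) := by
  refine ⟨fun h x y z hx hy hz m hm => ?_, fun h x y z hx hy hz m hm _ => h x y z hx hy hz m hm⟩
  have ha : ∀ k : M, a • k ∈ LinearMap.range (LinearMap.lsmul R M a) := fun k => ⟨k, rfl⟩
  have hexp : (x * y * (z + a)) • m = (x * y * z) • m + a • (x * y) • m := by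
    rw [smul_smul, ← add_smul]; congr 1; ring
  have hsum : (x * y * (z + a)) • m ∈ LinearMap.range (LinearMap.lsmul R M a) :=
    hexp ▸ add_mem hm (ha _)
  by_cases hu : IsUnit (z + a)
  · left
    rwa [mul_comm, mul_smul, Submodule.smul_mem_iff_of_isUnit _ hu] at hsum
  by_cases h₁ : (x * y * z) • m ∈ (LinearMap.range (LinearMap.lsmul R M a)).colon ⊤ •
      LinearMap.range (LinearMap.lsmul R M a)
  · by_cases h₂ : (x * y * (z + a)) • m ∈ (LinearMap.range (LinearMap.lsmul R M a)).colon ⊤ •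
        LinearMap.range (LinearMap.lsmul R M a)
    · left
      rw [hexp, Submodule.add_mem_iff_right _ h₁] at h₂
      obtain ⟨n, hn, hna⟩ := colon_smul_range_lsmul_le a h₂
      have hker : a • ((x * y) • m - n) = 0 := by
        rw [smul_sub, sub_eq_zero]; exact hna.symm
      exact (Submodule.sub_mem_iff_left _ hn).1 (htor _ hker)
    · refine (h x y (z + a) hx hy hu m hsum h₂).imp_right fun hza => ?_
      rwa [add_smul, Submodule.add_mem_iff_left _ (ha m)] at hza
  · exact h x y z hx hy hz m hm h₁
end

section
/- Let S be a multiplicatively closed subset of R, and let N be a φ-classical 1-absorbing prime submodule of M with (N :_R M) ∩ S = ∅. Then the localized submodule S⁻¹N of the S⁻¹R-module S⁻¹M satisfies: whenever nonunit elements x, y, z ∈ S⁻¹R and u ∈ S⁻¹M satisfy xyzu ∈ S⁻¹N \ S⁻¹(φ(N)), then xyu ∈ S⁻¹N or zu ∈ S⁻¹N. -/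
theorem IsLocalization.isUnit_mk'_of_isUnit {R : Type*} [CommRing R] {S : Submonoid R}
    (A : Type*) [CommRing A] [Algebra R A] [IsLocalization S A] {r : R} (hr : IsUnit r) (s : S) :
    IsUnit (IsLocalization.mk' A r s) := by
  have h := hr.map (algebraMap R A)
  rw [← IsLocalization.mk'_spec A r s] at h
  exact isUnit_of_mul_isUnit_left h

theorem Submodule.mk'_mem_localized_iff {R M : Type*} [CommRing R] [AddCommGroup M] [Module R M]
    (S : Submonoid R) (K : Submodule R M) (m : M) (s : S) :
    IsLocalizedModule.mk' (LocalizedModule.mkLinearMap S M) m s ∈ K.localized S ↔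
      ∃ t : S, t • m ∈ K := by
  rw [Submodule.mem_localized']
  constructor
  · rintro ⟨n, hn, r, h⟩
    obtain ⟨c, hc⟩ := (IsLocalizedModule.mk'_eq_mk'_iff _ n m r s).1 h
    refine ⟨c * r, ?_⟩
    rw [mul_smul, hc]
    exact K.smul_mem _ (K.smul_mem _ hn)
  · rintro ⟨t, ht⟩
    exact ⟨t • m, ht, t * s, IsLocalizedModule.mk'_cancel_left _ m t s⟩

/-- Let `S` be a multiplicatively closed subset of `R` and `N` a `φ`-classical
1-absorbing prime submodule of `M` with `(N :_R M) ∩ S = ∅`. Then whenever nonunits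
`x, y, z ∈ S⁻¹R` and `u ∈ S⁻¹M` satisfy `xyzu ∈ S⁻¹N \ S⁻¹(φ(N))`, we have `xyu ∈ S⁻¹N` or
`zu ∈ S⁻¹N`. -/
theorem localized_phi_classical_one_absorbing
    {R M : Type*} [CommRing R] [AddCommGroup M] [Module R M]
    (S : Submonoid R)
    (φ : Submodule R M → Submodule R M) (hφ : ∀ K : Submodule R M, φ K ≤ K)
    (N : Submodule R M) (hNproper : N ≠ ⊤)
    (hN : ∀ a b c : R, ¬ IsUnit a → ¬ IsUnit b → ¬ IsUnit c → ∀ m : M,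
      (a * b * c) • m ∈ N → (a * b * c) • m ∉ φ N → (a * b) • m ∈ N ∨ c • m ∈ N)
    (hdisj : ∀ r : R, r ∈ N.colon ⊤ → r ∉ S) :
    ∀ x y z : Localization S, ¬ IsUnit x → ¬ IsUnit y → ¬ IsUnit z →
      ∀ u : LocalizedModule S M,
        (x * y * z) • u ∈ N.localized S → (x * y * z) • u ∉ (φ N).localized S →
        (x * y) • u ∈ N.localized S ∨ z • u ∈ N.localized S := by
  intro x y z hx hy hz u hmem hnot
  obtain ⟨a, s, rfl⟩ := IsLocalization.exists_mk'_eq S x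
  obtain ⟨b, t, rfl⟩ := IsLocalization.exists_mk'_eq S y
  obtain ⟨c, r, rfl⟩ := IsLocalization.exists_mk'_eq S z
  obtain ⟨⟨m, v⟩, rfl⟩ :=
    IsLocalizedModule.mk'_surjective S (LocalizedModule.mkLinearMap S M) u
  have ha := mt (IsLocalization.isUnit_mk'_of_isUnit (Localization S) · s) hx
  have hb := mt (IsLocalization.isUnit_mk'_of_isUnit (Localization S) · t) hy
  have hc := mt (IsLocalization.isUnit_mk'_of_isUnit (Localization S) · r) hz
  simp only [Function.uncurry_apply_pair, ← IsLocalization.mk'_mul,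
    IsLocalizedModule.mk'_smul_mk', Submodule.mk'_mem_localized_iff] at hmem hnot ⊢
  obtain ⟨w, hw⟩ := hmem
  rw [smul_comm] at hw
  refine (hN a b c ha hb hc (w • m) hw
    fun h ↦ hnot ⟨w, by rwa [smul_comm]⟩).imp (fun h ↦ ⟨w, ?_⟩) (fun h ↦ ⟨w, ?_⟩)
  all_goals rwa [smul_comm]
end

section
/- Let N be a φ-classical 1-absorbing prime submodule of M and suppose abcK ⊆ N for nonunit elements a, b, c ∈ R and a submodule K of M. If (a, b, c, k) is not a φ-classical 1-quadruple-zero of N for any k ∈ K, then abK ⊆ N or cK ⊆ N. -/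
/-- Let `N` be a `φ`-classical 1-absorbing prime submodule of `M` and suppose
`abcK ⊆ N` for nonunits `a, b, c ∈ R` and a submodule `K` of `M`. If `(a, b, c, k)` is not a
`φ`-classical 1-quadruple-zero of `N` for any `k ∈ K`, then `abK ⊆ N` or `cK ⊆ N`. -/
theorem abK_subset_or_cK_subset_of_no_quadruple_zero
    {R M : Type*} [CommRing R] [AddCommGroup M] [Module R M]
    (φ : Submodule R M → Submodule R M) (hφ : ∀ L : Submodule R M, φ L ≤ L)
    (N : Submodule R M) (hNproper : N ≠ ⊤)
    (hN : ∀ a b c : R, ¬ IsUnit a → ¬ IsUnit b → ¬ IsUnit c → ∀ m : M,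
      (a * b * c) • m ∈ N → (a * b * c) • m ∉ φ N → (a * b) • m ∈ N ∨ c • m ∈ N)
    (a b c : R) (ha : ¬ IsUnit a) (hb : ¬ IsUnit b) (hc : ¬ IsUnit c)
    (K : Submodule R M)
    (habcK : ∀ k ∈ K, (a * b * c) • k ∈ N)
    (hnoquad : ∀ k ∈ K,
      ¬ ((a * b * c) • k ∈ φ N ∧ (a * b) • k ∉ N ∧ c • k ∉ N)) :
    (∀ k ∈ K, (a * b) • k ∈ N) ∨ (∀ k ∈ K, c • k ∈ N) := by
  have key : ∀ k ∈ K, (a * b) • k ∈ N ∨ c • k ∈ N := by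
    intro k hk
    by_contra! h
    by_cases hk' : (a * b * c) • k ∈ φ N
    · exact hnoquad k hk ⟨hk', h⟩
    · exact (hN a b c ha hb hc k (habcK k hk) hk').elim h.1 h.2
  by_contra! h
  obtain ⟨⟨x, hx, hxab⟩, y, hy, hyc⟩ := h
  have hxc := (key x hx).resolve_left hxab
  have hyab := (key y hy).resolve_right hyc
  rcases key (x + y) (K.add_mem hx hy) with h | h
  · rw [smul_add] at h
    exact hxab ((N.add_mem_iff_left hyab).1 h)
  · rw [smul_add] at h
    exact hyc ((N.add_mem_iff_right hxc).1 h)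
end

section
/- Let N be a φ-classical 1-absorbing prime submodule of M and suppose (a, b, c, m) is a φ-classical 1-quadruple-zero of N such that acm ∉ N and bcm ∉ N. Then (N :_R M)³N ⊆ φ(N). -/
/-- Membership in `N` is unaffected by perturbing scalars by `(N :_R M)` and vectors by `N`. -/
theorem Submodule.add_mul_add_smul_add_mem_iff {R M : Type*} [CommRing R] [AddCommGroup M]
    [Module R M] {N : Submodule R M} {x y : R} (hx : ∀ v : M, x • v ∈ N) (hy : ∀ v : M, y • v ∈ N)
    (a b : R) (m : M) {n : M} (hn : n ∈ N) :
    ((a + x) * (b + y)) • (m + n) ∈ N ↔ (a * b) • m ∈ N := by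
  have key : ((a + x) * (b + y)) • (m + n) =
      (a * b) • m + (a • y • m + x • (b + y) • m + ((a + x) * (b + y)) • n) := by module
  rw [key]
  exact N.add_mem_iff_left (N.add_mem (N.add_mem (N.smul_mem _ (hy _)) (hx _)) (N.smul_mem _ hn))

/-- Let `N` be a `φ`-classical 1-absorbing prime submodule of `M` and suppose
`(a, b, c, m)` is a `φ`-classical 1-quadruple-zero of `N` with `acm ∉ N` and `bcm ∉ N`. Then
`(N :_R M)³N ⊆ φ(N)`. -/
theorem colon_pow_three_smul_le_phi_of_quadruple_zero
    {R M : Type*} [CommRing R] [AddCommGroup M] [Module R M]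
    (φ : Submodule R M → Submodule R M) (hφ : ∀ K : Submodule R M, φ K ≤ K)
    (N : Submodule R M) (hNproper : N ≠ ⊤)
    (hN : ∀ a b c : R, ¬ IsUnit a → ¬ IsUnit b → ¬ IsUnit c → ∀ m : M,
      (a * b * c) • m ∈ N → (a * b * c) • m ∉ φ N → (a * b) • m ∈ N ∨ c • m ∈ N)
    (a b c : R) (ha : ¬ IsUnit a) (hb : ¬ IsUnit b) (hc : ¬ IsUnit c) (m : M)
    (hquad : (a * b * c) • m ∈ φ N ∧ (a * b) • m ∉ N ∧ c • m ∉ N)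
    (hac : (a * c) • m ∉ N) (hbc : (b * c) • m ∉ N) :
    (N.colon ⊤) ^ 3 • N ≤ φ N := by
  obtain ⟨habcm, habm, hcm⟩ := hquad
  have hcolon {x : R} (hx : x ∈ N.colon ⊤) (v : M) : x • v ∈ N :=
    Submodule.mem_colon.1 hx v trivial
  have key {x y z : R} (hx : x ∈ N.colon ⊤) (hy : y ∈ N.colon ⊤) (hz : z ∈ N.colon ⊤)
      {n : M} (hn : n ∈ N) : ((a + x) * (b + y) * (c + z)) • (m + n) ∈ φ N := by
    have hxy : ((a + x) * (b + y)) • (m + n) ∉ N := by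
      rwa [Submodule.add_mul_add_smul_add_mem_iff (hcolon hx) (hcolon hy) a b m hn]
    have hxz : ((a + x) * (c + z)) • (m + n) ∉ N := by
      rwa [Submodule.add_mul_add_smul_add_mem_iff (hcolon hx) (hcolon hz) a c m hn]
    have hyz : ((b + y) * (c + z)) • (m + n) ∉ N := by
      rwa [Submodule.add_mul_add_smul_add_mem_iff (hcolon hy) (hcolon hz) b c m hn]
    have hz' : (c + z) • (m + n) ∉ N := by
      have h := Submodule.add_mul_add_smul_add_mem_iff (hcolon (zero_mem (N.colon ⊤)))
        (hcolon hz) 1 c m hn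
      simp only [add_zero, one_mul] at h
      rwa [h]
    have hmem : ((a + x) * (b + y) * (c + z)) • (m + n) ∈ N := by
      have hxy' (v : M) : (a * y + x * (b + y)) • v ∈ N := by
        rw [add_smul, mul_smul, mul_smul]
        exact N.add_mem (N.smul_mem _ (hcolon hy _)) (hcolon hx _)
      have h := (Submodule.add_mul_add_smul_add_mem_iff hxy' (hcolon hz) (a * b) c m hn).2
        (hφ N habcm)
      convert h using 2
      ring
    by_contra hnot
    have hu : ¬ IsUnit (a + x) := fun h ↦ hyz <| (N.smul_mem_iff_of_isUnit h).1 <| by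
      rwa [← mul_smul, ← mul_assoc]
    have hv : ¬ IsUnit (b + y) := fun h ↦ hxz <| (N.smul_mem_iff_of_isUnit h).1 <| by
      rwa [← mul_smul, ← mul_assoc, mul_comm (b + y)]
    have hw : ¬ IsUnit (c + z) := fun h ↦ hxy <| (N.smul_mem_iff_of_isUnit h).1 <| by
      rwa [← mul_smul, mul_comm (c + z)]
    exact (hN _ _ _ hu hv hw _ hmem hnot).elim hxy hz'
  have hprod {x y z : R} (hx : x ∈ N.colon ⊤) (hy : y ∈ N.colon ⊤) (hz : z ∈ N.colon ⊤)
      {n : M} (hn : n ∈ N) : x • y • z • n ∈ φ N := by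
    have h0 : (0 : R) ∈ N.colon ⊤ := zero_mem _
    have diff_n {x y z : R} (hx : x ∈ N.colon ⊤) (hy : y ∈ N.colon ⊤) (hz : z ∈ N.colon ⊤) :
        ((a + x) * (b + y) * (c + z)) • n ∈ φ N := by
      simpa [smul_add] using sub_mem (key hx hy hz hn) (key hx hy hz N.zero_mem)
    have diff_z {x y : R} (hx : x ∈ N.colon ⊤) (hy : y ∈ N.colon ⊤) :
        ((a + x) * (b + y) * z) • n ∈ φ N := by
      convert sub_mem (diff_n hx hy hz) (diff_n hx hy h0) using 1
      module
    have diff_y {x : R} (hx : x ∈ N.colon ⊤) : ((a + x) * y * z) • n ∈ φ N := by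
      convert sub_mem (diff_z hx hy) (diff_z hx h0) using 1
      module
    convert sub_mem (diff_y hx) (diff_y h0) using 1
    module
  rw [pow_three, Submodule.mul_smul, Submodule.mul_smul, Submodule.smul_le]
  intro x hx
  change N.colon ⊤ • N.colon ⊤ • N ≤ (φ N).comap (LinearMap.lsmul R M x)
  rw [Submodule.smul_le]
  intro y hy
  change N.colon ⊤ • N ≤ ((φ N).comap (LinearMap.lsmul R M x)).comap (LinearMap.lsmul R M y)
  rw [Submodule.smul_le]
  exact fun z hz n hn ↦ hprod hx hy hz hn
end
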